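/- Fix d ∈ ℕ, δ ∈ (0,1), Δ₂ > 0, and σ ≥ Δ₂ √(2 log(1.25/δ)). Let Z be a random vector in ℝ^d whose d coordinates are independent centered Gaussians of variance σ² (i.e., Z has law N(0, σ² I_d)). Then for any x, x' ∈ ℝ^d with ‖x − x'‖₂ ≤ Δ₂ and any measurable S ⊆ ℝ^d, Pr(x + Z ∈ S) ≤ e^ε Pr(x' + Z ∈ S) + δ, where ε = (Δ₂/σ) √(2 log(1.25/δ)). Moreover E[‖Z‖₂²] = d σ². -/

import Mathlib

open MeasureTheory ProbabilityTheory
open scoped NNReal ENNReal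

/-- One-dimensional Cameron-Martin formula. -/
lemma gm_cm1 (m : ℝ) {v : ℝ≥0} (hv : v ≠ 0) :
    gaussianReal m v = (gaussianReal 0 v).withDensity
      (fun z => ENNReal.ofReal (Real.exp ((2 * (m * z) - m ^ 2) / (2 * v)))) := by
  rw [gaussianReal_of_var_ne_zero _ hv, gaussianReal_of_var_ne_zero _ hv,
    ← withDensity_mul _ (measurable_gaussianPDF _ _) (by fun_prop)]
  congr 1
  ext z
  have hv' : (0 : ℝ) < v := by exact_mod_cast pos_iff_ne_zero.mpr hv
  simp only [Pi.mul_apply, gaussianPDF, gaussianPDFReal]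
  rw [← ENNReal.ofReal_mul (by positivity), mul_assoc (√_)⁻¹, ← Real.exp_add]
  congr 3
  field_simp
  ring

lemma gm_cm {d : ℕ} (w : Fin d → ℝ) {v : ℝ≥0} (hv : v ≠ 0) :
    (Measure.pi fun j => gaussianReal (w j) v) =
      (Measure.pi fun _ : Fin d => gaussianReal 0 v).withDensity
      (fun z => ENNReal.ofReal
        (Real.exp ((2 * (∑ j, w j * z j) - ∑ j, w j ^ 2) / (2 * v)))) := by
  apply Measure.pi_eq
  intro s hs
  rw [withDensity_apply _ (MeasurableSet.univ_pi hs),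
    ← lintegral_indicator (MeasurableSet.univ_pi hs)]
  have key := lintegral_prod_eq_prod_lintegral_of_indepFun
    (μ := Measure.pi fun _ : Fin d => gaussianReal 0 v) Finset.univ
    (fun j z => (s j).indicator
      (fun t => ENNReal.ofReal (Real.exp ((2 * (w j * t) - w j ^ 2) / (2 * v)))) (z j))
    (iIndepFun_pi (X := fun j => (s j).indicator
      (fun t => ENNReal.ofReal (Real.exp ((2 * (w j * t) - w j ^ 2) / (2 * v)))))
      (fun j => (Measurable.indicator (by fun_prop) (hs j)).aemeasurable))
    (fun j => (Measurable.indicator (by fun_prop) (hs j)).comp (measurable_pi_apply j))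
  calc _ = _ := ?_
    _ = _ := key
    _ = _ := ?_
  · congr 1
    ext z
    by_cases hz : z ∈ Set.univ.pi s
    · rw [Set.indicator_of_mem hz]
      have : ∀ j, z j ∈ s j := fun j => hz j trivial
      simp only [Set.indicator_of_mem (this _)]
      rw [← ENNReal.ofReal_prod_of_nonneg (fun _ _ => (Real.exp_pos _).le), ← Real.exp_sum,
        ← Finset.sum_div, Finset.sum_sub_distrib, Finset.mul_sum]
    · rw [Set.indicator_of_notMem hz]
      simp only [Set.mem_pi, Set.mem_univ, true_imp_iff, not_forall] at hz
      obtain ⟨j, hj⟩ := hz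
      rw [Finset.prod_eq_zero (Finset.mem_univ j)]
      exact Set.indicator_of_notMem hj _
  · refine Finset.prod_congr rfl fun j _ => ?_
    have hm : Measurable ((s j).indicator
      (fun t => ENNReal.ofReal (Real.exp ((2 * (w j * t) - w j ^ 2) / (2 * v))))) :=
      Measurable.indicator (by fun_prop) (hs j)
    have := (measurePreserving_eval (fun _ : Fin d => gaussianReal 0 v) j).lintegral_comp hm
    simp only [Function.eval] at this
    rw [this, lintegral_indicator (hs j), ← withDensity_apply _ (hs j), ← gm_cm1 (w j) hv]

lemma gm_half : gaussianReal 0 1 (Set.Ioi 0) ≤ ENNReal.ofReal (1 / 2) := by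
  have h1 : gaussianReal 0 1 (Set.Ioi 0) = gaussianReal 0 1 (Set.Iio 0) := by
    have h := gaussianReal_map_neg (μ := 0) (v := 1)
    rw [neg_zero] at h
    conv_lhs => rw [← h]
    rw [Measure.map_apply measurable_neg measurableSet_Ioi]
    congr 1
    ext z
    simp
  have h2 : gaussianReal 0 1 (Set.Ioi 0) + gaussianReal 0 1 (Set.Iio 0) ≤ 1 := by
    rw [← measure_union _ measurableSet_Iio]
    · exact prob_le_one
    · rw [Set.disjoint_left]
      intro a ha hb
      exact lt_asymm (Set.mem_Ioi.mp ha) hb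
  rw [← h1] at h2
  have h3 := ENNReal.toReal_mono ENNReal.one_ne_top h2
  rw [ENNReal.toReal_add (measure_ne_top _ _) (measure_ne_top _ _), ENNReal.toReal_one] at h3
  rw [← ENNReal.ofReal_toReal (measure_ne_top (gaussianReal 0 1) (Set.Ioi 0))]
  exact ENNReal.ofReal_le_ofReal (by linarith)

lemma gm_tail_pos {t : ℝ} (ht : 0 ≤ t) :
    gaussianReal 0 1 (Set.Ioi t) ≤ ENNReal.ofReal (Real.exp (-t ^ 2 / 2) * (1 / 2)) := by
  have h : gaussianReal 0 1 (Set.Ioi t) = gaussianReal (-t) 1 (Set.Ioi 0) := by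
    have h := gaussianReal_map_add_const (μ := 0) (v := 1) (-t)
    rw [zero_add] at h
    rw [← h, Measure.map_apply (by fun_prop) measurableSet_Ioi]
    congr 1
    ext z
    simp
  rw [h, gm_cm1 (-t) one_ne_zero, withDensity_apply _ measurableSet_Ioi,
    ENNReal.ofReal_mul (Real.exp_pos _).le]
  calc _ ≤ ∫⁻ _ in Set.Ioi (0 : ℝ), ENNReal.ofReal (Real.exp (-t ^ 2 / 2)) ∂(gaussianReal 0 1) := by
        refine setLIntegral_mono (by fun_prop) fun z hz => ?_
        apply ENNReal.ofReal_le_ofReal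
        apply Real.exp_le_exp.mpr
        have : 0 ≤ t * z := mul_nonneg ht (le_of_lt hz)
        simp only [NNReal.coe_one]
        linarith
    _ ≤ _ := by
        rw [setLIntegral_const]
        gcongr
        exact gm_half

lemma gm_tail_neg {t : ℝ} (ht : t ≤ 0) :
    gaussianReal 0 1 (Set.Ioi t) ≤ ENNReal.ofReal (1 / 2 - t) := by
  rw [← Set.Ioc_union_Ioi_eq_Ioi ht]
  refine (measure_union_le _ _).trans ?_
  rw [show 1 / 2 - t = (0 - t) + 1 / 2 by ring, ENNReal.ofReal_add (by linarith) (by norm_num)]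
  refine add_le_add ?_ gm_half
  rw [gaussianReal_apply _ one_ne_zero, ← Real.volume_Ioc]
  calc _ ≤ ∫⁻ _ in Set.Ioc t 0, 1 := by
        refine setLIntegral_mono (by fun_prop) fun z hz => ?_
        rw [gaussianPDF, ENNReal.ofReal_le_one, gaussianPDFReal]
        have h1 : (√(2 * Real.pi * ((1 : ℝ≥0) : ℝ)))⁻¹ ≤ 1 := by
          apply inv_le_one_of_one_le₀
          rw [Real.one_le_sqrt]
          simp only [NNReal.coe_one]
          linarith [Real.pi_gt_three]
        have h2 : Real.exp (-(z - 0) ^ 2 / (2 * ((1 : ℝ≥0) : ℝ))) ≤ 1 := by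
          rw [Real.exp_le_one_iff]
          simp only [NNReal.coe_one]
          nlinarith [sq_nonneg (z - 0)]
        exact mul_le_one₀ h1 (Real.exp_pos _).le h2
    _ = _ := by simp

lemma gm_tail {δ c : ℝ} (hδ0 : 0 < δ) (hδ1 : δ < 1)
    (hc : c = Real.sqrt (2 * Real.log (1.25 / δ))) :
    gaussianReal 0 1 (Set.Ioi (c - 1 / (2 * c))) ≤ ENNReal.ofReal δ := by
  have hlog : 1 / 5 ≤ Real.log (1.25 / δ) := by
    have h1 := Real.one_sub_inv_le_log_of_pos (x := 1.25 / δ) (by positivity)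
    have h2 : (1.25 / δ)⁻¹ = δ / 1.25 := by rw [inv_div]
    rw [h2] at h1
    norm_num at h1 ⊢
    linarith
  have hc2 : c ^ 2 = 2 * Real.log (1.25 / δ) := by rw [hc, Real.sq_sqrt (by linarith)]
  have hc0 : 0 < c := by rw [hc]; apply Real.sqrt_pos.mpr; linarith
  have hδ : δ = 1.25 * Real.exp (-c ^ 2 / 2) := by
    rw [show -c ^ 2 / 2 = - Real.log (1.25 / δ) by rw [neg_div, hc2]; ring, Real.exp_neg,
      Real.exp_log (by positivity)]
    field_simp
  have hct : c * (c - 1 / (2 * c)) = c ^ 2 - 1 / 2 := by field_simp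
  rcases le_total 0 (c - 1 / (2 * c)) with h | h
  · refine (gm_tail_pos h).trans (ENNReal.ofReal_le_ofReal ?_)
    have h1 : -(c - 1 / (2 * c)) ^ 2 / 2 ≤ -c ^ 2 / 2 + 1 / 2 := by
      have : (c - 1 / (2 * c)) ^ 2 = c ^ 2 - 1 + (1 / (2 * c)) ^ 2 := by field_simp; ring
      rw [this]
      nlinarith [sq_nonneg (1 / (2 * c))]
    have h2 : Real.exp (1 / 2) ≤ 2.5 := by
      have h3 : Real.exp (1 / 2) ≤ Real.exp 1 / 1 := by
        rw [div_one]; exact Real.exp_le_exp.mpr (by norm_num)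
      have h4 : Real.exp (1 / 2) ^ 2 = Real.exp 1 := by
        rw [← Real.exp_nat_mul]; norm_num
      nlinarith [Real.exp_one_lt_d9, Real.exp_pos (1 / 2)]
    have h3 := Real.exp_le_exp.mpr h1
    rw [Real.exp_add] at h3
    rw [hδ]
    nlinarith [Real.exp_pos (-c ^ 2 / 2)]
  · refine (gm_tail_neg h).trans (ENNReal.ofReal_le_ofReal ?_)
    have h1 : c ^ 2 ≤ 1 / 2 := by nlinarith
    have h2 := Real.add_one_le_exp (-c ^ 2 / 2)
    have h3 : 15 / 16 ≤ δ := by rw [hδ]; norm_num; linarith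
    have h4 : 3 / 5 ≤ c := by nlinarith
    have h5 : -(1 / 6) ≤ c - 1 / (2 * c) := by nlinarith
    linarith

/-- The law of a linear functional of the noise. -/
lemma gm_law {d : ℕ} (w : Fin d → ℝ) (σ : ℝ) (v : ℝ≥0) (hv : (v : ℝ) = σ ^ 2) :
    (Measure.pi fun _ : Fin d => gaussianReal 0 v).map
      (fun z => ∑ j, w j * z j) =
      (gaussianReal 0 1).map (fun g => (σ * √(∑ j, w j ^ 2)) * g) := by
  have hmem : ∀ j, MemLp (fun t : ℝ => w j * t) 2 (gaussianReal 0 v) := fun j =>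
    (memLp_id_gaussianReal' 2 (by simp)).const_mul (w j)
  have hlaw : HasGaussianLaw (fun z : Fin d → ℝ => ∑ j, w j * z j)
      (Measure.pi fun _ : Fin d => gaussianReal 0 v) := by
    apply iIndepFun.hasGaussianLaw_fun_sum (X := fun j (z : Fin d → ℝ) => w j * z j)
    · intro j
      have h1 : HasLaw (fun z : Fin d → ℝ => z j) (gaussianReal 0 v)
          (Measure.pi fun _ : Fin d => gaussianReal 0 v) :=
        ⟨(measurable_pi_apply j).aemeasurable, (measurePreserving_eval _ j).map_eq⟩
      exact h1.hasGaussianLaw.fun_smul (w j)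
    · exact iIndepFun_pi (X := fun j (t : ℝ) => w j * t) (fun j => by fun_prop)
  rw [hlaw.map_eq_gaussianReal, gaussianReal_map_const_mul]
  have hmean : ∫ z, (∑ j, w j * z j) ∂(Measure.pi fun _ : Fin d => gaussianReal 0 v) = 0 := by
    rw [integral_finsetSum]
    · apply Finset.sum_eq_zero
      intro j _
      rw [integral_const_mul, integral_eval]
      simp
    · intro j _
      exact ((hmem j).comp_measurePreserving (measurePreserving_eval _ j)).integrable (by norm_num)
  have hvar : Var[fun z : Fin d → ℝ => ∑ j, w j * z j;
      Measure.pi fun _ : Fin d => gaussianReal 0 v] = σ ^ 2 * ∑ j, w j ^ 2 := by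
    have h := variance_sum_pi hmem
    have h0 : (∑ j, fun z : Fin d → ℝ => w j * z j) = fun z => ∑ j, w j * z j := by
      ext z; simp
    rw [h0] at h
    rw [h, Finset.mul_sum]
    refine Finset.sum_congr rfl fun j _ => ?_
    rw [variance_const_mul, variance_fun_id_gaussianReal, mul_comm, hv]
  rw [hmean, hvar, mul_zero]
  congr 1
  ext
  rw [Real.coe_toNNReal _ (by positivity)]
  simp [mul_pow, Real.sq_sqrt (Finset.sum_nonneg fun j _ => sq_nonneg (w j))]



/-- the `d`-dimensional Gaussian mechanism with noise `N(0, σ²I_d)`,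
`σ ≥ Δ₂√(2 log(1.25/δ))`, is `(ε, δ)`-differentially private for inputs at
`ℓ₂`-distance at most `Δ₂`, with `ε = (Δ₂/σ)√(2 log(1.25/δ))`; its expected
squared `ℓ₂` noise norm is `dσ²`. -/
theorem gaussian_mechanism
    (d : ℕ) (δ Δ σ : ℝ) (hδ0 : 0 < δ) (hδ1 : δ < 1) (hΔ : 0 < Δ)
    (hσ : Δ * Real.sqrt (2 * Real.log (1.25 / δ)) ≤ σ)
    (x x' : Fin d → ℝ) (hxx : Real.sqrt (∑ j, (x j - x' j) ^ 2) ≤ Δ) :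
    (∀ S : Set (Fin d → ℝ), MeasurableSet S →
      (Measure.pi fun _ : Fin d => gaussianReal 0 ⟨σ ^ 2, sq_nonneg σ⟩)
          {z | (fun j => x j + z j) ∈ S}
        ≤ ENNReal.ofReal (Real.exp (Δ / σ * Real.sqrt (2 * Real.log (1.25 / δ)))) *
            (Measure.pi fun _ : Fin d => gaussianReal 0 ⟨σ ^ 2, sq_nonneg σ⟩)
              {z | (fun j => x' j + z j) ∈ S}
          + ENNReal.ofReal δ)
    ∧ ∫ z, (∑ j, (z j) ^ 2)
          ∂(Measure.pi fun _ : Fin d => gaussianReal 0 ⟨σ ^ 2, sq_nonneg σ⟩)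
        = d * σ ^ 2 := by
  have hlog : 0 < Real.log (1.25 / δ) := by
    apply Real.log_pos
    rw [lt_div_iff₀ hδ0]
    norm_num
    linarith
  set c := Real.sqrt (2 * Real.log (1.25 / δ)) with hc
  have hc0 : 0 < c := by rw [hc]; apply Real.sqrt_pos.mpr; linarith
  have hσ0 : 0 < σ := lt_of_lt_of_le (mul_pos hΔ hc0) hσ
  obtain ⟨v, hvdef⟩ : ∃ v : NNReal, v = ⟨σ ^ 2, sq_nonneg σ⟩ := ⟨_, rfl⟩
  have hvσ : (v : ℝ) = σ ^ 2 := by rw [hvdef]; rfl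
  rw [← hvdef]
  clear hvdef
  have hv : v ≠ 0 := by
    rintro rfl
    have : σ ^ 2 = 0 := hvσ.symm
    exact absurd this (by positivity)
  constructor
  · intro S hS
    set μ := Measure.pi fun _ : Fin d => gaussianReal 0 v with hμ
    set w : Fin d → ℝ := fun j => x j - x' j with hw
    set r := Real.sqrt (∑ j, (x j - x' j) ^ 2) with hr
    have hr0 : 0 ≤ r := Real.sqrt_nonneg _
    have hr2 : ∑ j, w j ^ 2 = r ^ 2 := by
      rw [hr, Real.sq_sqrt (Finset.sum_nonneg fun j _ => sq_nonneg _)]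
    set T : Set (Fin d → ℝ) := {z | (fun j => x' j + z j) ∈ S} with hT
    have hTm : MeasurableSet T := by
      have : Measurable (fun (z : Fin d → ℝ) j => x' j + z j) := by fun_prop
      exact this hS
    have hmap : μ.map (fun z j => z j + w j) =
        Measure.pi fun j => gaussianReal (w j) v := by
      have h := Measure.pi_map_pi
        (μ := fun _ : Fin d => gaussianReal 0 v)
        (f := fun j t => t + w j)
        (hμ := fun j => by rw [gaussianReal_map_add_const]; infer_instance)
        (fun j => by fun_prop)
      rw [hμ, h]
      congr 1
      ext j : 1
      rw [gaussianReal_map_add_const, zero_add]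
    have hsm : Measurable (fun (z : Fin d → ℝ) j => z j + w j) := by fun_prop
    have hA : {z : Fin d → ℝ | (fun j => x j + z j) ∈ S} = (fun z j => z j + w j) ⁻¹' T := by
      ext z
      simp only [hT, hw, Set.mem_ofPred_eq, Set.mem_preimage]
      have : (fun j => x j + z j) = fun j => x' j + (z j + (x j - x' j)) := by
        ext j; ring
      rw [this]
    set L : (Fin d → ℝ) → ℝ := fun z => (2 * (∑ j, w j * z j) - ∑ j, w j ^ 2) / (2 * σ ^ 2) with hL
    have hLm : Measurable L := by fun_prop
    set ε := Δ / σ * c with hε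
    set B : Set (Fin d → ℝ) := {z | L z ≤ ε} with hB
    have hBm : MeasurableSet B := measurableSet_le hLm measurable_const
    have hcm : μ.map (fun z j => z j + w j) =
        μ.withDensity (fun z => ENNReal.ofReal (Real.exp (L z))) := by
      rw [hmap, gm_cm w hv, hvσ]
    rw [hA, ← Measure.map_apply hsm hTm]
    rw [← measure_inter_add_sdiff T hBm]
    refine add_le_add ?_ ?_
    · rw [hcm, withDensity_apply _ (hTm.inter hBm)]
      calc _ ≤ ∫⁻ _ in T ∩ B, ENNReal.ofReal (Real.exp ε) ∂μ := by
            refine setLIntegral_mono (by fun_prop) fun z hz => ?_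
            exact ENNReal.ofReal_le_ofReal (Real.exp_le_exp.mpr hz.2)
        _ ≤ _ := by
            rw [setLIntegral_const]
            gcongr
            exact Set.inter_subset_left
    · refine le_trans ?_ (gm_tail hδ0 hδ1 hc)
      calc μ.map (fun z j => z j + w j) (T \ B) ≤ μ.map (fun z j => z j + w j) Bᶜ :=
            measure_mono fun z hz => hz.2
        _ = μ ((fun z => ∑ j, w j * z j) ⁻¹' Set.Ioi (σ * Δ * c - r ^ 2 / 2)) := by
            rw [Measure.map_apply hsm hBm.compl]
            congr 1
            ext z
            simp only [hB, hL, Set.mem_preimage, Set.mem_compl_iff, Set.mem_ofPred_eq, not_le,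
              Set.mem_Ioi, hr2]
            have h1 : ∑ j, w j * (z j + w j) = ∑ j, w j * z j + r ^ 2 := by
              rw [← hr2, ← Finset.sum_add_distrib]
              exact Finset.sum_congr rfl fun j _ => by ring
            rw [h1, lt_div_iff₀ (by positivity)]
            have h2 : ε * (2 * σ ^ 2) = 2 * (σ * Δ * c) := by rw [hε]; field_simp
            rw [h2]
            constructor <;> intro h <;> linarith
        _ = gaussianReal 0 1 ((fun g => (σ * r) * g) ⁻¹' Set.Ioi (σ * Δ * c - r ^ 2 / 2)) := by
            have h1 := gm_law w σ v hvσ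
            rw [← Measure.map_apply (by fun_prop) measurableSet_Ioi, hμ, h1,
              Measure.map_apply (by fun_prop) measurableSet_Ioi]
        _ ≤ _ := by
            refine measure_mono fun g hg => ?_
            simp only [Set.mem_preimage, Set.mem_Ioi] at hg ⊢
            rcases hr0.eq_or_lt with h0 | h0
            · rw [← h0] at hg
              have : 0 < σ * Δ * c := by positivity
              nlinarith
            · have h1 : Δ / (2 * σ) ≤ 1 / (2 * c) := by
                rw [div_le_div_iff₀ (by positivity) (by positivity)]
                linarith
              have h2 : c - Δ / (2 * σ) < g := by
                have h3 : r / (2 * σ) ≤ Δ / (2 * σ) := by gcongr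
                have h4 : c - r / (2 * σ) < g := by
                  have h5 : σ * r * (c - r / (2 * σ)) < σ * r * g := by
                    have h6 : σ * r * (c - r / (2 * σ)) = σ * r * c - r ^ 2 / 2 := by
                      field_simp
                    have h7 : σ * r * c ≤ σ * Δ * c := by gcongr
                    linarith
                  exact lt_of_mul_lt_mul_left h5 (by positivity)
                linarith
              linarith
  · have hmem : MemLp (fun t : ℝ => t) 2 (gaussianReal 0 v) :=
      memLp_id_gaussianReal' 2 (by simp)
    have hsq : ∫ t, t ^ 2 ∂(gaussianReal 0 v) = σ ^ 2 := by
      have h1 := variance_fun_id_gaussianReal (μ := 0) (v := v)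
      rw [variance_of_integral_eq_zero (by fun_prop) (by simp)] at h1
      rw [← hvσ]
      exact h1
    rw [integral_finsetSum]
    · have : ∀ j : Fin d, ∫ z, (z j) ^ 2
          ∂(Measure.pi fun _ : Fin d => gaussianReal 0 v) = σ ^ 2 := by
        intro j
        rw [← hsq]
        exact integral_comp_eval (μ := fun _ : Fin d => gaussianReal 0 v)
          (i := j) (f := fun t : ℝ => t ^ 2) (by fun_prop)
      simp [this]
    · intro j _
      exact (hmem.comp_measurePreserving (measurePreserving_eval _ j)).integrable_sq
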